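/- arXiv:1203.1991 — 6 statements merged into one kernel-verified Lean document; each statement's English description precedes it below -/
import Mathlib

section
/- Let a = (a_1,…,a_n) be integers with 0 < a_1 < ⋯ < a_n, n ≥ 2, and let j be a positive integer with j > a_n². If the sequence a+(j) = (j, j+a_1, …, j+a_n) admits a CI split of type (m, n+1−m) for some 1 ≤ m ≤ n, then m = 1 or m = n. -/
/-- The numerical semigroup `⟨c₁,…,c_m⟩` (as an additive submonoid of `ℕ`)
generated by a finite set `B`: all nonnegative integer combinations of the
elements of `B`. -/
def numSemigroup (B : Finset ℕ) : AddSubmonoid ℕ := AddSubmonoid.closure (B : Set ℕ)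

/-- Delorme's characterization, taken as the definition of a complete
intersection (CI) sequence, for a finite set of distinct positive integers:
either the set is a singleton, or it can be partitioned into two disjoint
nonempty parts `k₁ • B₁` and `k₂ • B₂` with `gcd(k₁,k₂) = 1`,
`k₁ ∈ ⟨B₂⟩ \ B₂`, `k₂ ∈ ⟨B₁⟩ \ B₁`, and `B₁`, `B₂` themselves CI. -/
inductive IsCI : Finset ℕ → Prop
  | single (c : ℕ) : IsCI {c}
  | split (S B₁ B₂ : Finset ℕ) (k₁ k₂ : ℕ) :
      B₁.Nonempty → B₂.Nonempty →
      S = B₁.image (fun x => k₁ * x) ∪ B₂.image (fun x => k₂ * x) →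
      Disjoint (B₁.image (fun x => k₁ * x)) (B₂.image (fun x => k₂ * x)) →
      Nat.gcd k₁ k₂ = 1 →
      k₁ ∈ numSemigroup B₂ → k₁ ∉ B₂ →
      k₂ ∈ numSemigroup B₁ → k₂ ∉ B₁ →
      IsCI B₁ → IsCI B₂ → IsCI S

/-- A CI split of the set `S` into the two parts `k₁ • B₁` and `k₂ • B₂`
(of type `(|B₁|, |B₂|)`). -/
def IsCISplit (S B₁ B₂ : Finset ℕ) (k₁ k₂ : ℕ) : Prop :=
  B₁.Nonempty ∧ B₂.Nonempty ∧
  S = B₁.image (fun x => k₁ * x) ∪ B₂.image (fun x => k₂ * x) ∧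
  Disjoint (B₁.image (fun x => k₁ * x)) (B₂.image (fun x => k₂ * x)) ∧
  Nat.gcd k₁ k₂ = 1 ∧
  k₁ ∈ numSemigroup B₂ ∧ k₁ ∉ B₂ ∧
  k₂ ∈ numSemigroup B₁ ∧ k₂ ∉ B₁ ∧
  IsCI B₁ ∧ IsCI B₂

/-- The translated sequence `a + (j) = (j, j+a₁, …, j+aₙ)` as a finite set. -/
def jSet (n : ℕ) (a : Fin n → ℕ) (j : ℕ) : Finset ℕ :=
  insert j (Finset.image (fun i => j + a i) Finset.univ)

/-- A nonzero element of the semigroup generated by `B` is at least some generator. -/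
theorem exists_le_of_mem_numSemigroup {B : Finset ℕ} {x : ℕ} (hx : x ∈ numSemigroup B)
    (hx0 : x ≠ 0) : ∃ b ∈ B, b ≤ x := by
  unfold numSemigroup at hx
  induction hx using AddSubmonoid.closure_induction with
  | mem x h => exact ⟨x, h, le_rfl⟩
  | zero => exact absurd rfl hx0
  | add x y _ _ ihx ihy =>
    by_cases h : x = 0
    · obtain ⟨b, hb, hle⟩ := ihy (by omega)
      exact ⟨b, hb, by omega⟩
    · obtain ⟨b, hb, hle⟩ := ihx h
      exact ⟨b, hb, by omega⟩

/-- If all multiples `k * b`, for `b` in a set with at least two elements, lie in an interval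
of length `A`, then `k ≤ A`. -/
theorem le_of_forall_mul_mem_Icc {B : Finset ℕ} {k j A : ℕ} (hB : 1 < B.card)
    (h : ∀ b ∈ B, j ≤ k * b ∧ k * b ≤ j + A) : k ≤ A := by
  obtain ⟨x, hx, y, hy, hne⟩ := Finset.one_lt_card.mp hB
  wlog hlt : x < y generalizing x y
  · exact this y hy x hx hne.symm (by omega)
  have hxy : k * (x + 1) ≤ k * y := Nat.mul_le_mul_left k hlt
  have := (h x hx).1
  have := (h y hy).2
  rw [mul_add, mul_one] at hxy
  omega

theorem jSet_card {n : ℕ} {a : Fin n → ℕ} (ha : ∀ i, 0 < a i) (hinj : Function.Injective a)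
    (j : ℕ) : (jSet n a j).card = n + 1 := by
  rw [jSet, Finset.card_insert_of_notMem, Finset.card_image_of_injective, Finset.card_univ,
    Fintype.card_fin]
  · exact fun x y h => hinj (Nat.add_left_cancel h)
  · simp only [Finset.mem_image, Finset.mem_univ, true_and, not_exists]
    intro i h
    have := ha i
    omega

theorem mem_jSet_bounds {n : ℕ} {a : Fin n → ℕ} {A : ℕ} (hA : ∀ i, a i ≤ A) {j x : ℕ}
    (hx : x ∈ jSet n a j) : j ≤ x ∧ x ≤ j + A := by
  simp only [jSet, Finset.mem_insert, Finset.mem_image, Finset.mem_univ, true_and] at hx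
  obtain rfl | ⟨i, rfl⟩ := hx
  · omega
  · have := hA i
    omega

/-- Lemma `split-type1`: if `j > aₙ²` and the translated
sequence `a+(j) = (j, j+a₁, …, j+aₙ)` admits a CI split of type
`(m, n+1-m)` with `1 ≤ m ≤ n`, then `m = 1` or `m = n`. -/
theorem ci_split_type_extreme (n : ℕ) (hn : 2 ≤ n) (a : Fin n → ℕ)
    (ha0 : 0 < a ⟨0, by omega⟩) (hmono : StrictMono a)
    (j : ℕ) (hj : (a ⟨n - 1, by omega⟩) ^ 2 < j)
    (B₁ B₂ : Finset ℕ) (k₁ k₂ : ℕ)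
    (hsplit : IsCISplit (jSet n a j) B₁ B₂ k₁ k₂)
    (m : ℕ) (hm : B₁.card = m) (hm1 : 1 ≤ m) (hm2 : m ≤ n) :
    m = 1 ∨ m = n := by
  obtain ⟨⟨b₁, hb₁⟩, ⟨b₂, hb₂⟩, hS, hdisj, -, hk₁, -, -, -, -, -⟩ := hsplit
  set A := a ⟨n - 1, by omega⟩
  have hA : ∀ i, a i ≤ A := fun i => hmono.monotone (Fin.mk_le_mk.mpr (by omega))
  have hpos : ∀ i, 0 < a i := fun i =>
    ha0.trans_le (hmono.monotone (Fin.mk_le_mk.mpr (Nat.zero_le _)))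
  have bound₁ : ∀ b ∈ B₁, j ≤ k₁ * b ∧ k₁ * b ≤ j + A := fun b hb =>
    mem_jSet_bounds hA (hS ▸ Finset.mem_union_left _ (Finset.mem_image_of_mem _ hb))
  have bound₂ : ∀ b ∈ B₂, j ≤ k₂ * b ∧ k₂ * b ≤ j + A := fun b hb =>
    mem_jSet_bounds hA (hS ▸ Finset.mem_union_right _ (Finset.mem_image_of_mem _ hb))
  have hk₁0 : k₁ ≠ 0 := by
    rintro rfl
    have := (bound₁ b₁ hb₁).1
    omega
  have hk₂0 : k₂ ≠ 0 := by
    rintro rfl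
    have := (bound₂ b₂ hb₂).1
    omega
  have hcard : n + 1 = B₁.card + B₂.card := by
    rw [← jSet_card hpos hmono.injective j, hS, Finset.card_union_of_disjoint hdisj,
      Finset.card_image_of_injective _ (mul_right_injective₀ hk₁0),
      Finset.card_image_of_injective _ (mul_right_injective₀ hk₂0)]
  by_contra! hcon
  have hk₁A : k₁ ≤ A := le_of_forall_mul_mem_Icc (by omega) bound₁
  have hk₂A : k₂ ≤ A := le_of_forall_mul_mem_Icc (by omega) bound₂
  obtain ⟨b, hb, hle⟩ := exists_le_of_mem_numSemigroup hk₁ hk₁0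
  have hmul : k₂ * b ≤ A * A := Nat.mul_le_mul hk₂A (hle.trans hk₁A)
  have := (bound₂ b hb).1
  rw [sq] at hj
  omega
end

section
/- For every integer m ≥ 2, the sequence (7m, 7m+4, 7m+7) is a CI sequence. -/
/-- Two coprime integers greater than `1` form a CI sequence. -/
theorem IsCI.pair_of_coprime {a b : ℕ} (ha : 1 < a) (hb : 1 < b) (hab : Nat.Coprime a b) :
    IsCI {a, b} := by
  have one_generates (k : ℕ) : k ∈ numSemigroup {1} := by
    simp [numSemigroup]
  have hne : a ≠ b := by
    rintro rfl
    exact ha.ne' ((Nat.coprime_self a).1 hab)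
  refine IsCI.split _ {1} {1} a b (by simp) (by simp) ?_ (by simpa using hne) hab
    (one_generates a) (by simpa using ha.ne') (one_generates b) (by simpa using hb.ne')
    (.single 1) (.single 1)
  simp

/-- for every `m ≥ 2`, `(7m, 7m+4, 7m+7)` is a CI sequence. -/
theorem ci_example_7m (m : ℕ) (hm : 2 ≤ m) :
    IsCI {7 * m, 7 * m + 4, 7 * m + 7} := by
  have hcoprime : Nat.gcd 7 (7 * m + 4) = 1 := by simp
  have hmem : 7 * m + 4 ∈ numSemigroup {m, m + 1} := by
    have h₀ : m ∈ numSemigroup {m, m + 1} := AddSubmonoid.subset_closure (by simp)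
    have h₁ : m + 1 ∈ numSemigroup {m, m + 1} := AddSubmonoid.subset_closure (by simp)
    have h := add_mem (nsmul_mem h₀ 3) (nsmul_mem h₁ 4)
    simp only [smul_eq_mul] at h
    convert h using 1
    ring
  refine IsCI.split _ {m, m + 1} {1} 7 (7 * m + 4) (by simp) (by simp) ?_ ?_ hcoprime
    (by simp [numSemigroup]) (by simp) hmem ?_
    (IsCI.pair_of_coprime (by omega) (by omega) (by simp)) (.single 1)
  · ext x
    simp only [Finset.mem_insert, Finset.mem_singleton, Finset.mem_union, Finset.image_insert,
      Finset.image_singleton]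
    omega
  · simp only [Finset.image_insert, Finset.image_singleton, Finset.disjoint_singleton_right,
      Finset.mem_insert, Finset.mem_singleton]
    omega
  · simp only [Finset.mem_insert, Finset.mem_singleton]
    omega
end

section
/- For every integer m ≥ 2, the sequence (28m, 28m+11, 28m+16, 28m+28) is a CI sequence. -/
theorem mem_numSemigroup_of_mem {B : Finset ℕ} {b : ℕ} (hb : b ∈ B) : b ∈ numSemigroup B :=
  AddSubmonoid.subset_closure hb

theorem mem_numSemigroup_one (n : ℕ) : n ∈ numSemigroup {1} := by
  simpa using nsmul_mem (mem_numSemigroup_of_mem (Finset.mem_singleton_self 1)) n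

/-- Gluing a single generator `k₂` onto `k₁ • B` preserves the CI property. -/
theorem IsCI.insert_image {B : Finset ℕ} {k₁ k₂ : ℕ} (hB : IsCI B) (hne : B.Nonempty)
    (hk₁ : 1 < k₁) (hgcd : Nat.gcd k₁ k₂ = 1) (hmem : k₂ ∈ numSemigroup B) (hnot : k₂ ∉ B) :
    IsCI (insert k₂ (B.image fun x => k₁ * x)) := by
  refine .split _ B {1} k₁ k₂ hne (Finset.singleton_nonempty 1) ?_ ?_ hgcd
    (mem_numSemigroup_one k₁) (by simpa using hk₁.ne') hmem hnot hB (.single 1)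
  · ext; simp
  · simp only [Finset.image_singleton, mul_one, Finset.disjoint_singleton_right, Finset.mem_image,
      not_exists, not_and]
    rintro x - rfl
    rw [Nat.gcd_mul_right_right] at hgcd
    exact hk₁.ne' hgcd

theorem isCI_pair {a b : ℕ} (ha : 1 < a) (hb : 1 < b) (h : Nat.gcd a b = 1) : IsCI {a, b} := by
  have := (IsCI.single 1).insert_image (Finset.singleton_nonempty 1) ha h
    (mem_numSemigroup_one b) (by simpa using hb.ne')
  simpa [Finset.pair_comm] using this

theorem isCI_triple {m : ℕ} (hm : 2 ≤ m) : IsCI {7 * m, 7 * m + 4, 7 * m + 7} := by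
  have hmem : 7 * m + 4 ∈ numSemigroup {m, m + 1} := by
    have h : 7 * m + 4 = 3 • m + 4 • (m + 1) := by simp only [smul_eq_mul]; ring
    rw [h]
    exact add_mem (nsmul_mem (mem_numSemigroup_of_mem (by simp)) 3)
      (nsmul_mem (mem_numSemigroup_of_mem (by simp)) 4)
  have h := (isCI_pair (a := m) (b := m + 1) (by omega) (by omega) (by simp)).insert_image
    (by simp) (k₁ := 7) (by norm_num) (by simp) hmem
    (by simp only [Finset.mem_insert, Finset.mem_singleton]; omega)
  convert h using 1
  ext x
  simp only [Finset.image_insert, Finset.image_singleton, Finset.mem_insert, Finset.mem_singleton]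
  omega

/-- for every `m ≥ 2`, `(28m, 28m+11, 28m+16, 28m+28)` is a
CI sequence. -/
theorem ci_example_28m (m : ℕ) (hm : 2 ≤ m) :
    IsCI {28 * m, 28 * m + 11, 28 * m + 16, 28 * m + 28} := by
  have hmem : 28 * m + 11 ∈ numSemigroup {7 * m, 7 * m + 4, 7 * m + 7} := by
    have h : 28 * m + 11 = 2 • (7 * m) + (7 * m + 4) + (7 * m + 7) := by
      simp only [smul_eq_mul]; ring
    rw [h]
    exact add_mem (add_mem (nsmul_mem (mem_numSemigroup_of_mem (by simp)) 2)
      (mem_numSemigroup_of_mem (by simp))) (mem_numSemigroup_of_mem (by simp))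
  have hgcd : Nat.gcd 4 (28 * m + 11) = 1 := by
    rw [show 28 * m + 11 = 11 + 4 * (7 * m) by ring, Nat.gcd_add_mul_left_right]
    rfl
  have h := (isCI_triple hm).insert_image (by simp) (k₁ := 4) (by norm_num) hgcd hmem
    (by simp only [Finset.mem_insert, Finset.mem_singleton]; omega)
  convert h using 1
  ext x
  simp only [Finset.image_insert, Finset.image_singleton, Finset.mem_insert, Finset.mem_singleton]
  omega
end

section
/- The set CI((3,8,20)) = { j ∈ ℤ_+ : (j, j+3, j+8, j+20) is a CI sequence } is finite; that is, there exists N such that for all j > N, the sequence (j, j+3, j+8, j+20) is not a CI sequence. -/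
/-- A nonzero element of the semigroup is at least as large as some generator. -/
theorem exists_mem_le_of_mem_numSemigroup {B : Finset ℕ} {k : ℕ} (hk : k ∈ numSemigroup B)
    (hk0 : k ≠ 0) : ∃ b ∈ B, b ≤ k := by
  unfold numSemigroup at hk
  induction hk using AddSubmonoid.closure_induction with
  | mem x hx => exact ⟨x, by simpa using hx, le_rfl⟩
  | zero => exact absurd rfl hk0
  | add x y _ _ hx hy =>
    rcases Nat.eq_zero_or_pos x with rfl | hx0
    · obtain ⟨b, hb, hle⟩ := hy (by simpa using hk0)
      exact ⟨b, hb, by omega⟩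
    · obtain ⟨b, hb, hle⟩ := hx hx0.ne'
      exact ⟨b, hb, by omega⟩

theorem dvd_of_mem_numSemigroup_singleton {b k : ℕ} (hk : k ∈ numSemigroup {b}) : b ∣ k := by
  unfold numSemigroup at hk
  rw [Finset.coe_singleton, AddSubmonoid.mem_closure_singleton] at hk
  obtain ⟨n, rfl⟩ := hk
  exact ⟨n, by simp [mul_comm]⟩

/-- If every `k * x` with `x ∈ B` is one of `j`, `j + 8`, `j + 20`, then `k * y`, for `y` in the
semigroup generated by `B`, is a nonnegative combination of these three numbers. -/
theorem exists_combination_of_mem_numSemigroup {B : Finset ℕ} {j k y : ℕ}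
    (hB : ∀ x ∈ B, k * x = j ∨ k * x = j + 8 ∨ k * x = j + 20) (hy : y ∈ numSemigroup B) :
    ∃ n a c : ℕ, k * y = n * j + 8 * a + 20 * c ∧ a + c ≤ n := by
  unfold numSemigroup at hy
  induction hy using AddSubmonoid.closure_induction with
  | mem x hx =>
    rcases hB x (by simpa using hx) with h | h | h
    · exact ⟨1, 0, 0, by omega, by omega⟩
    · exact ⟨1, 1, 0, by omega, by omega⟩
    · exact ⟨1, 0, 1, by omega, by omega⟩
  | zero => exact ⟨0, 0, 0, by simp, by simp⟩
  | add x y _ _ hx hy =>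
    obtain ⟨n, a, c, h, hle⟩ := hx
    obtain ⟨n', a', c', h', hle'⟩ := hy
    exact ⟨n + n', a + a', c + c', by rw [mul_add, h, h']; ring, by omega⟩

/-- Two distinct multiples of `k` in an interval of length `d` force `k ≤ d`. -/
theorem le_of_nontrivial_of_mul_mem_Icc {B : Finset ℕ} {k j d : ℕ} (hB : B.Nontrivial)
    (h : ∀ x ∈ B, j ≤ k * x ∧ k * x ≤ j + d) : k ≤ d := by
  obtain ⟨x, hx, y, hy, hxy⟩ := hB
  wlog hlt : x < y generalizing x y
  · exact this y hy x hx hxy.symm (by omega)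
  have h1 := h x hx
  have h2 := h y hy
  have h3 : k * (x + 1) ≤ k * y := Nat.mul_le_mul_left k hlt
  rw [mul_add] at h3
  omega

/-- For large `j` there is no splitting of `{j, j + 3, j + 8, j + 20}` with a singleton part. -/
theorem false_of_split_singleton {j k₁ k₂ b : ℕ} {B : Finset ℕ} (hj : 400 < j)
    (hS : ({j, j + 3, j + 8, j + 20} : Finset ℕ) =
      B.image (fun x => k₁ * x) ∪ ({b} : Finset ℕ).image (fun x => k₂ * x))
    (hdisj : Disjoint (B.image (fun x => k₁ * x)) (({b} : Finset ℕ).image (fun x => k₂ * x)))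
    (hk₁ : k₁ ∈ numSemigroup {b}) (hk₁b : k₁ ∉ ({b} : Finset ℕ))
    (hk₂ : k₂ ∈ numSemigroup B) : False := by
  have hbk : b ∣ k₁ := dvd_of_mem_numSemigroup_singleton hk₁
  have hne : k₁ ≠ b := by simpa using hk₁b
  have hmem : ∀ s ∈ ({j, j + 3, j + 8, j + 20} : Finset ℕ), k₁ ∣ s ∨ s = k₂ * b := by
    intro s hs
    rw [hS] at hs
    simp only [Finset.mem_union, Finset.mem_image, Finset.mem_singleton, exists_eq_left] at hs
    rcases hs with ⟨x, -, rfl⟩ | h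
    · exact Or.inl ⟨x, rfl⟩
    · exact Or.inr h.symm
  have h0 := hmem j (by simp)
  have h3 := hmem (j + 3) (by simp)
  have h8 := hmem (j + 8) (by simp)
  have h20 := hmem (j + 20) (by simp)
  have hk₁ne : k₁ ≠ 1 := by
    rintro rfl
    exact hne (Nat.dvd_one.mp hbk).symm
  have hdiff : ∀ u v : ℕ, k₁ ∣ j + u → k₁ ∣ j + (u + v) → k₁ ∣ v := by
    intro u v hu hv
    rw [← add_assoc] at hv
    exact (Nat.dvd_add_right hu).mp hv
  have hcop : ∀ u v : ℕ, Nat.gcd u v = 1 → k₁ ∣ u → ¬ k₁ ∣ v := fun u v huv hu hv =>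
    hk₁ne (Nat.dvd_one.mp (huv ▸ Nat.dvd_gcd hu hv))
  have hb3 : k₂ * b = j + 3 := by
    have hb : k₂ * b ∈ ({j, j + 3, j + 8, j + 20} : Finset ℕ) := by
      rw [hS]; simp
    simp only [Finset.mem_insert, Finset.mem_singleton] at hb
    rcases hb with h | h | h | h
    · have d3 := h3.resolve_right (by omega)
      have d8 := h8.resolve_right (by omega)
      have d20 := h20.resolve_right (by omega)
      exact (hcop 5 12 (by norm_num) (hdiff 3 5 d3 d8) (hdiff 8 12 d8 d20)).elim
    · exact h
    · have d0 := h0.resolve_right (by omega)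
      have d3 := h3.resolve_right (by omega)
      have d20 := h20.resolve_right (by omega)
      exact (hcop 3 17 (by norm_num) (hdiff 0 3 d0 d3) (hdiff 3 17 d3 d20)).elim
    · have d0 := h0.resolve_right (by omega)
      have d3 := h3.resolve_right (by omega)
      have d8 := h8.resolve_right (by omega)
      exact (hcop 3 5 (by norm_num) (hdiff 0 3 d0 d3) (hdiff 3 5 d3 d8)).elim
  have d0 := h0.resolve_right (by omega)
  have d8 := h8.resolve_right (by omega)
  have d20 := h20.resolve_right (by omega)
  have hk4 : k₁ ∣ 4 :=
    (Nat.dvd_gcd (hdiff 0 8 d0 d8) (hdiff 8 12 d8 d20) : k₁ ∣ Nat.gcd 8 12)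
  have hb1 : b = 1 := by
    have h3' : b ∣ 3 := (Nat.dvd_add_right (hbk.trans d0)).mp (hb3 ▸ Dvd.intro_left k₂ rfl)
    exact Nat.dvd_one.mp (Nat.dvd_gcd h3' (hbk.trans hk4) : b ∣ Nat.gcd 3 4)
  subst hb1
  rw [mul_one] at hb3
  subst hb3
  have hB : ∀ x ∈ B, k₁ * x = j ∨ k₁ * x = j + 8 ∨ k₁ * x = j + 20 := by
    intro x hx
    have hxi : k₁ * x ∈ B.image (fun x => k₁ * x) := Finset.mem_image_of_mem _ hx
    have hxS : k₁ * x ∈ ({j, j + 3, j + 8, j + 20} : Finset ℕ) := by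
      rw [hS]; exact Finset.mem_union_left _ hxi
    have hx3 : k₁ * x ≠ j + 3 := by
      intro h
      exact Finset.disjoint_left.mp hdisj hxi (by simp [h])
    simp only [Finset.mem_insert, Finset.mem_singleton] at hxS
    tauto
  obtain ⟨n, a, c, h, hle⟩ := exists_combination_of_mem_numSemigroup hB hk₂
  have hk₁le : k₁ ≤ 4 := Nat.le_of_dvd (by norm_num) hk4
  have hn : n ≤ 4 := by
    by_contra! hn
    have h5 : 5 * j ≤ n * j := Nat.mul_le_mul_right j hn
    have h4 : k₁ * (j + 3) ≤ 4 * (j + 3) := Nat.mul_le_mul_right _ hk₁le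
    omega
  interval_cases k₁ <;> interval_cases n <;> omega

/-- Example `ex1`: the set
`CI((3,8,20)) = {j ∈ ℤ₊ : (j, j+3, j+8, j+20) is CI}` is finite; that is,
there is `N` such that for all `j > N` the sequence `(j, j+3, j+8, j+20)` is
not CI. -/
theorem ci_example_3_8_20_finite :
    ∃ N : ℕ, ∀ j > N, ¬ IsCI ({j, j + 3, j + 8, j + 20} : Finset ℕ) := by
  refine ⟨400, fun j hj hCI => ?_⟩
  generalize hT : ({j, j + 3, j + 8, j + 20} : Finset ℕ) = T at hCI
  cases hCI with
  | single c =>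
    have h0 : j ∈ ({c} : Finset ℕ) := by rw [← hT]; simp
    have h3 : j + 3 ∈ ({c} : Finset ℕ) := by rw [← hT]; simp
    simp only [Finset.mem_singleton] at h0 h3
    omega
  | split _ B₁ B₂ k₁ k₂ hB₁ hB₂ hS hdisj _ hk₁ hk₁B hk₂ hk₂B _ _ =>
    subst hS
    rcases hB₂.exists_eq_singleton_or_nontrivial with ⟨b, rfl⟩ | hB₂
    · exact false_of_split_singleton hj hT hdisj hk₁ hk₁B hk₂
    rcases hB₁.exists_eq_singleton_or_nontrivial with ⟨b, rfl⟩ | hB₁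
    · rw [Finset.union_comm] at hT
      exact false_of_split_singleton hj hT hdisj.symm hk₂ hk₂B hk₁
    have hbd : ∀ s ∈ B₁.image (fun x => k₁ * x) ∪ B₂.image (fun x => k₂ * x),
        j ≤ s ∧ s ≤ j + 20 := by
      intro s hs
      rw [← hT] at hs
      simp only [Finset.mem_insert, Finset.mem_singleton] at hs
      omega
    have hbd₁ : ∀ x ∈ B₁, j ≤ k₁ * x ∧ k₁ * x ≤ j + 20 := fun x hx =>
      hbd _ (Finset.mem_union_left _ (Finset.mem_image_of_mem _ hx))
    have hbd₂ : ∀ x ∈ B₂, j ≤ k₂ * x ∧ k₂ * x ≤ j + 20 := fun x hx =>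
      hbd _ (Finset.mem_union_right _ (Finset.mem_image_of_mem _ hx))
    have hk₁0 : k₁ ≠ 0 := by
      rintro rfl
      obtain ⟨x, hx⟩ := hB₁.nonempty
      have := hbd₁ x hx
      omega
    obtain ⟨b, hb, hbk⟩ := exists_mem_le_of_mem_numSemigroup hk₁ hk₁0
    have h := (hbd₂ b hb).1
    have hle : k₂ * b ≤ 20 * 20 :=
      Nat.mul_le_mul (le_of_nontrivial_of_mul_mem_Icc hB₂ hbd₂)
        (hbk.trans (le_of_nontrivial_of_mul_mem_Icc hB₁ hbd₁))
    omega
end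

section
/- The sequence (8, 17, 18) is a CI sequence, but for every integer j > 324 the sequence (j, j+8, j+17, j+18) is not a CI sequence. (Hence the converse of the statement 'if (j, j+a_1,…,j+a_n) is CI for j ≫ 0 then (a_1,…,a_n) is CI' fails.) -/
/-- A nonzero element of `⟨B⟩` is at least any lower bound of `B`. -/
theorem le_of_mem_numSemigroup {B : Finset ℕ} {t k : ℕ} (hB : ∀ x ∈ B, t ≤ x)
    (hk : k ∈ numSemigroup B) (hk0 : k ≠ 0) : t ≤ k := by
  have h : k = 0 ∨ t ≤ k := by
    induction hk using AddSubmonoid.closure_induction with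
    | mem x hx => exact Or.inr (hB x hx)
    | zero => exact Or.inl rfl
    | add x y _ _ hx hy => omega
  exact h.resolve_left hk0

/-- If `B ⊆ {m, m + 4, m + 9}` and `m > 17`, then `2 * m + 17 ∉ ⟨B⟩`. -/
theorem two_mul_add_notMem_numSemigroup {B : Finset ℕ} {m : ℕ} (hm : 17 < m)
    (hB : ∀ x ∈ B, x = m ∨ x = m + 4 ∨ x = m + 9) : 2 * m + 17 ∉ numSemigroup B := by
  intro hk
  have h : ∀ y ∈ numSemigroup B, y = 0 ∨ (y = m ∨ y = m + 4 ∨ y = m + 9) ∨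
      (y = 2 * m ∨ y = 2 * m + 4 ∨ y = 2 * m + 8 ∨ y = 2 * m + 9 ∨ y = 2 * m + 13 ∨
        y = 2 * m + 18) ∨ 3 * m ≤ y := by
    intro y hy
    induction hy using AddSubmonoid.closure_induction with
    | mem x hx => exact Or.inr (Or.inl (hB x hx))
    | zero => exact Or.inl rfl
    | add x y _ _ hx hy => omega
  have := h _ hk
  omega

/-- If two distinct multiples of `k` lie in an interval of length `18`, then `k ≤ 18`. -/
theorem le_of_nontrivial_mul_mem {B : Finset ℕ} {k j : ℕ} (hB : B.Nontrivial)
    (h : ∀ x ∈ B, j ≤ k * x ∧ k * x ≤ j + 18) : k ≤ 18 := by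
  obtain ⟨x, hx, y, hy, hxy⟩ := hB
  have hx' := h x hx
  have hy' := h y hy
  rcases Nat.lt_or_gt_of_ne hxy with hlt | hlt <;> nlinarith

/-- `{j, j + 8, j + 17, j + 18}` has no split with a part of size one. -/
theorem not_split_singleton {j : ℕ} (hj : 324 < j) {b k₁ k₂ : ℕ} {B : Finset ℕ}
    (hS : ∀ s, (s = j ∨ s = j + 8 ∨ s = j + 17 ∨ s = j + 18) ↔
      s = k₁ * b ∨ ∃ x ∈ B, k₂ * x = s)
    (hk₁ : k₁ ∈ numSemigroup B) (hk₂ : k₂ ∈ numSemigroup {b}) (hne : k₂ ≠ b) : False := by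
  have hb : b ∣ k₂ := dvd_of_mem_numSemigroup_singleton hk₂
  have hdvd : ∀ s, (s = j ∨ s = j + 8 ∨ s = j + 17 ∨ s = j + 18) → s ≠ k₁ * b → k₂ ∣ s := by
    intro s hs hsne
    obtain ⟨x, -, rfl⟩ := ((hS s).1 hs).resolve_left hsne
    exact dvd_mul_right _ _
  have hk1 : k₂ ≠ 1 := by
    rintro rfl
    exact hne (Nat.dvd_one.1 hb).symm
  have h1 : ¬ k₂ ∣ 1 := fun h => hk1 (Nat.dvd_one.1 h)
  have h17 : k₁ * b = j + 17 := by
    by_contra hcon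
    have d17 := hdvd (j + 17) (by simp) (Ne.symm hcon)
    rcases (hS (k₁ * b)).2 (Or.inl rfl) with h | h | h | h
    · have d18 := hdvd (j + 18) (by simp) (by omega)
      exact h1 ((Nat.dvd_add_right d17).1 d18)
    · have d18 := hdvd (j + 18) (by simp) (by omega)
      exact h1 ((Nat.dvd_add_right d17).1 d18)
    · exact hcon h
    · have d0 := hdvd j (by simp) (by omega)
      have d8 := hdvd (j + 8) (by simp) (by omega)
      have e8 := (Nat.dvd_add_right d0).1 d8
      have e17 := (Nat.dvd_add_right d0).1 d17
      exact h1 (by simpa using Nat.dvd_gcd e8 e17)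
  have d0 := hdvd j (by simp) (by omega)
  have e8 := (Nat.dvd_add_right d0).1 (hdvd (j + 8) (by simp) (by omega))
  have e18 := (Nat.dvd_add_right d0).1 (hdvd (j + 18) (by simp) (by omega))
  have e2 : k₂ ∣ 2 := by simpa using Nat.dvd_gcd e8 e18
  obtain rfl : k₂ = 2 := ((Nat.dvd_prime Nat.prime_two).1 e2).resolve_left hk1
  obtain rfl : b = 1 := ((Nat.dvd_prime Nat.prime_two).1 hb).resolve_right (Ne.symm hne)
  obtain ⟨m, rfl⟩ := d0
  obtain rfl : k₁ = 2 * m + 17 := by omega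
  refine two_mul_add_notMem_numSemigroup (by omega) (fun x hx => ?_) hk₁
  have h := (hS (2 * x)).2 (Or.inr ⟨x, hx, rfl⟩)
  omega

theorem isCI_eight_seventeen_eighteen : IsCI ({8, 17, 18} : Finset ℕ) := by
  have mem_one : ∀ n : ℕ, n ∈ numSemigroup {1} := fun n => by
    simp [numSemigroup]
  have h49 : IsCI ({4, 9} : Finset ℕ) :=
    IsCI.split _ {1} {1} 4 9 (by simp) (by simp) (by decide) (by decide) (by norm_num)
      (mem_one _) (by decide) (mem_one _) (by decide) (IsCI.single 1) (IsCI.single 1)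
  refine IsCI.split _ {4, 9} {1} 2 17 (by simp) (by simp) (by decide) (by decide) (by norm_num)
    (mem_one _) (by decide) ?_ (by decide) h49 (IsCI.single 1)
  have h4 : 4 ∈ numSemigroup {4, 9} := AddSubmonoid.subset_closure (by simp)
  have h9 : 9 ∈ numSemigroup {4, 9} := AddSubmonoid.subset_closure (by simp)
  exact add_mem (add_mem h4 h4) h9

theorem not_isCI_translate {j : ℕ} (hj : 324 < j) :
    ¬ IsCI ({j, j + 8, j + 17, j + 18} : Finset ℕ) := by
  intro h
  generalize hT : ({j, j + 8, j + 17, j + 18} : Finset ℕ) = T at h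
  cases h with
  | single c =>
    have h0 : j ∈ ({c} : Finset ℕ) := hT ▸ by simp
    have h8 : j + 8 ∈ ({c} : Finset ℕ) := hT ▸ by simp
    simp only [Finset.mem_singleton] at h0 h8
    omega
  | split _ B₁ B₂ k₁ k₂ ne₁ ne₂ hS _ _ hk₁ hk₁' hk₂ hk₂' _ _ =>
    have hmem : ∀ s, (s = j ∨ s = j + 8 ∨ s = j + 17 ∨ s = j + 18) ↔
        (∃ x ∈ B₁, k₁ * x = s) ∨ ∃ x ∈ B₂, k₂ * x = s := by
      intro s
      have := Finset.ext_iff.1 (hT.trans hS) s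
      simpa using this
    have hb₁ : ∀ x ∈ B₁, j ≤ k₁ * x ∧ k₁ * x ≤ j + 18 := fun x hx => by
      have := (hmem _).2 (Or.inl ⟨x, hx, rfl⟩)
      omega
    have hb₂ : ∀ x ∈ B₂, j ≤ k₂ * x ∧ k₂ * x ≤ j + 18 := fun x hx => by
      have := (hmem _).2 (Or.inr ⟨x, hx, rfl⟩)
      omega
    rcases ne₁.exists_eq_singleton_or_nontrivial with ⟨b, rfl⟩ | nt₁
    · refine not_split_singleton hj (fun s => ?_) hk₁ hk₂ (by simpa using hk₂')
      simpa [eq_comm] using hmem s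
    rcases ne₂.exists_eq_singleton_or_nontrivial with ⟨b, rfl⟩ | nt₂
    · refine not_split_singleton hj (fun s => ?_) hk₂ hk₁ (by simpa using hk₁')
      simpa [eq_comm, or_comm] using hmem s
    have hk₁_le := le_of_nontrivial_mul_mem nt₁ hb₁
    have hk₂_le := le_of_nontrivial_mul_mem nt₂ hb₂
    have hk₁_ne : k₁ ≠ 0 := by
      rintro rfl
      obtain ⟨x, hx⟩ := ne₁
      have := hb₁ x hx
      omega
    have := le_of_mem_numSemigroup (t := 19) (fun x hx => by nlinarith [hb₂ x hx]) hk₁ hk₁_ne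
    omega

/-- Example `ex2`: `(8, 17, 18)` is CI, but for every
`j > 324 = 18²` the sequence `(j, j+8, j+17, j+18)` is not CI. -/
theorem ci_example_8_17_18 :
    IsCI ({8, 17, 18} : Finset ℕ) ∧
    ∀ j : ℕ, 324 < j → ¬ IsCI ({j, j + 8, j + 17, j + 18} : Finset ℕ) :=
  ⟨isCI_eight_seventeen_eighteen, fun _ hj => not_isCI_translate hj⟩
end

section
/- Let a_1 < a_2 < ⋯ < a_n be positive integers, let s ∈ {1,…,n}, and let k be a positive integer with k ≤ a_n such that k divides a_i for every i ≠ s. Let j be a positive integer with j > a_n² and k ∣ j. Suppose α_0 and α_i (for i ≠ s) are nonnegative integers satisfying k·(j + a_s) = α_0·j + Σ_{i ≠ s} α_i·(j + a_i). Then α_0 + Σ_{i ≠ s} α_i = k. -/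
/-- Claim 1 in the proof of Theorem `main`: if `k ≤ aₙ`,
`k ∣ aᵢ` for all `i ≠ s`, `j > aₙ²`, `k ∣ j`, and
`k(j + a_s) = α₀·j + Σ_{i ≠ s} αᵢ·(j + aᵢ)` with all coefficients
nonnegative, then `α₀ + Σ_{i ≠ s} αᵢ = k`. -/
theorem ci_claim_coeff_sum (n : ℕ) (hn : 1 ≤ n) (a : Fin n → ℕ)
    (ha0 : 0 < a ⟨0, by omega⟩) (hmono : StrictMono a)
    (s : Fin n) (k : ℕ) (hk : 0 < k) (hkan : k ≤ a ⟨n - 1, by omega⟩)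
    (hdvd : ∀ i : Fin n, i ≠ s → k ∣ a i)
    (j : ℕ) (hj : (a ⟨n - 1, by omega⟩) ^ 2 < j) (hkj : k ∣ j)
    (α₀ : ℕ) (α : Fin n → ℕ)
    (heq : k * (j + a s) =
      α₀ * j + ∑ i ∈ Finset.univ.erase s, α i * (j + a i)) :
    α₀ + ∑ i ∈ Finset.univ.erase s, α i = k := by
  set A := a ⟨n - 1, by omega⟩ with hA
  have hle (i : Fin n) : a i ≤ A :=
    hmono.monotone (Fin.le_def.mpr (by have := i.isLt; simp only; omega))
  set T := ∑ i ∈ Finset.univ.erase s, α i * a i with hT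
  set S := ∑ i ∈ Finset.univ.erase s, α i with hS
  have hsum : ∑ i ∈ Finset.univ.erase s, α i * (j + a i) = S * j + T := by
    simp only [mul_add, Finset.sum_add_distrib, hS, hT, Finset.sum_mul]
  have hTS : T ≤ S * A := by
    rw [hT, hS, Finset.sum_mul]
    exact Finset.sum_le_sum fun i _ => Nat.mul_le_mul_left _ (hle i)
  rw [hsum] at heq
  have hks : k * a s ≤ A * A := Nat.mul_le_mul hkan (hle s)
  rcases lt_trichotomy (α₀ + S) k with h | h | h
  · have hSA : S * A ≤ A * A := Nat.mul_le_mul_right _ (by omega)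
    have hmul : (α₀ + S + 1) * j ≤ k * j := Nat.mul_le_mul_right _ h
    nlinarith
  · exact h
  · have hmul : (k + 1) * j ≤ (α₀ + S) * j := Nat.mul_le_mul_right _ h
    nlinarith
end
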